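/- Upper bounds for ε_n(α,τ) under Sobolev regularity of the truth (Lemma 3.3(i)): Let p ∈ [1,2], α, τ > 0, and let Π(·|α,τ) be the α-regular τ-scaled p-exponential prior. Fix K > 0 and let ε_n(α,τ) be the unique solution of Π(θ : ‖θ−θ₀‖₂ ≤ Kε_n|α,τ) = e^{−nε_n²}. Suppose θ₀ ∈ H^β with β > 0. Define ε̃_n(α,τ) = n^{−α/(1+2α)}τ^{1/(1+2α)} + (nτ^p)^{β/(β(p−2)−αp−1)} if β < α+1/p; ε̃_n(α,τ) = n^{−α/(1+2α)}τ^{1/(1+2α)} + (nτ^p)^{−1/2} if β > α+1/p; and ε̃_n(α,τ) = n^{−α/(1+2α)}τ^{1/(1+2α)} + (nτ^p)^{−1/2}[log(√(nτ^p))]^{1/2−p/4} if β = α+1/p. Then for any C̃, L > 0 there exists a constant C > 0, depending on θ₀ only through ‖θ₀‖_{H^β} ≤ L and chosen uniformly over all τ with ε_n(α,τ)/τ ≤ C̃, such that ε_n(α,τ) ≤ C ε̃_n(α,τ) for all n. -/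

import Mathlib

noncomputable section

open MeasureTheory ProbabilityTheory Filter Set

/-- The index `ℓ = i + 1 ≥ 1` associated to the coordinate `i : ℕ`. -/
def idx (i : ℕ) : ℝ := (i : ℝ) + 1

/-- The `p`-exponential probability density on `ℝ`:
`f_p(x) = exp(−|x|^p/p) / (2 Γ(1/p) p^{1/p−1})`. -/
def pexpDensity (p x : ℝ) : ℝ :=
  Real.exp (-|x| ^ p / p) / (2 * Real.Gamma (1 / p) * p ^ (1 / p - 1))

/-- The `p`-exponential probability measure on `ℝ`. -/
def pexpMeasure (p : ℝ) : Measure ℝ :=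
  MeasureTheory.volume.withDensity fun x => ENNReal.ofReal (pexpDensity p x)

/-- The law of the `i`-th coordinate `τ ℓ^{−1/2−α} ξ` (with `ℓ = i+1`) of a draw from the
`α`-regular `τ`-scaled `p`-exponential prior. -/
def coordLaw (p α τ : ℝ) (i : ℕ) : Measure ℝ :=
  (pexpMeasure p).map fun x => τ * idx i ^ (-(1 / 2 : ℝ) - α) * x

/-- `μ` is the `α`-regular `τ`-scaled `p`-exponential prior on `ℝ^ℕ`: the joint law of the
independent coordinates `τ ℓ^{−1/2−α} ξ_ℓ` with `ξ_ℓ` i.i.d. `p`-exponential. -/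
def IsPexpPrior (p α τ : ℝ) (μ : Measure (ℕ → ℝ)) : Prop :=
  IsProbabilityMeasure μ ∧
  IsProjectiveLimit μ fun I : Finset ℕ => Measure.pi fun i : I => coordLaw p α τ i

/-- `μ` is the Gaussian sequence model measure `P^n_θ`: the joint law of independent
coordinates `X_ℓ ~ N(θ_ℓ, 1/n)`. -/
def IsGaussModel (n : ℕ) (θ : ℕ → ℝ) (μ : Measure (ℕ → ℝ)) : Prop :=
  IsProbabilityMeasure μ ∧
  IsProjectiveLimit μ fun I : Finset ℕ =>
    Measure.pi fun i : I => gaussianReal (θ i) ((n : NNReal))⁻¹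

/-- The `ℓ₂` norm of a sequence (with the `tsum` junk-value convention). -/
def l2norm (θ : ℕ → ℝ) : ℝ := Real.sqrt (∑' i, θ i ^ 2)

/-- Membership in the Sobolev ball `H^β(L)`. -/
def inSobolevBall (β L : ℝ) (θ : ℕ → ℝ) : Prop :=
  Summable (fun i => idx i ^ (2 * β) * θ i ^ 2) ∧
    Real.sqrt (∑' i, idx i ^ (2 * β) * θ i ^ 2) ≤ L

/-- The log-likelihood `ℓ_n(θ) = n Σ_ℓ X_ℓ θ_ℓ − (n/2) ‖θ‖₂²` in the Gaussian sequence model. -/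
def loglik (n : ℕ) (θ X : ℕ → ℝ) : ℝ :=
  (n : ℝ) * (∑' i, X i * θ i) - (n : ℝ) / 2 * ∑' i, θ i ^ 2

/-- The likelihood ratio `p^n_θ(X) = dP^n_θ/dP^n_0 (X)`. -/
def lik (n : ℕ) (θ X : ℕ → ℝ) : ℝ := Real.exp (loglik n θ X)

/-- The marginal likelihood of the data `X` for the prior `prior`. -/
def marginalLik (n : ℕ) (prior : Measure (ℕ → ℝ)) (X : ℕ → ℝ) : ℝ :=
  ∫ θ, lik n θ X ∂prior

/-- The posterior mass of a set `B` given data `X`, for the prior `prior`. -/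
def post (n : ℕ) (prior : Measure (ℕ → ℝ)) (X : ℕ → ℝ) (B : Set (ℕ → ℝ)) : ℝ :=
  (∫ θ in B, lik n θ X ∂prior) / marginalLik n prior X

/-- The upper bound `ε̃_n(α,τ)` of Lemma 3.3(i), for a Sobolev truth of regularity `β`. -/
def epsTildeSob (p α β : ℝ) (n : ℕ) (τ : ℝ) : ℝ :=
  (n : ℝ) ^ (-(α / (1 + 2 * α))) * τ ^ (1 / (1 + 2 * α)) +
    (if β < α + 1 / p then ((n : ℝ) * τ ^ p) ^ (β / (β * (p - 2) - α * p - 1))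
     else if α + 1 / p < β then ((n : ℝ) * τ ^ p) ^ (-(1 / 2) : ℝ)
     else ((n : ℝ) * τ ^ p) ^ (-(1 / 2) : ℝ) *
       Real.log (Real.sqrt ((n : ℝ) * τ ^ p)) ^ ((1 : ℝ) / 2 - p / 4))

theorem idx_pos (i : ℕ) : 0 < idx i := by unfold idx; positivity

theorem one_le_idx (i : ℕ) : 1 ≤ idx i := by unfold idx; linarith [i.cast_nonneg (α := ℝ)]

section Density

variable {p : ℝ}

theorem pexpDensity_const_pos (hp : 0 < p) :
    0 < 2 * Real.Gamma (1 / p) * p ^ (1 / p - 1) := by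
  have := Real.Gamma_pos_of_pos (one_div_pos.2 hp)
  positivity

theorem pexpDensity_pos (hp : 0 < p) (x : ℝ) : 0 < pexpDensity p x :=
  div_pos (Real.exp_pos _) (pexpDensity_const_pos hp)

theorem pexpDensity_neg (p x : ℝ) : pexpDensity p (-x) = pexpDensity p x := by
  simp [pexpDensity]

theorem continuous_pexpDensity (hp : 0 < p) : Continuous (pexpDensity p) := by
  unfold pexpDensity
  refine Continuous.div_const ?_ _
  refine Real.continuous_exp.comp (Continuous.div_const ?_ _)
  exact (continuous_abs.rpow_const fun x => Or.inr hp.le).neg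

theorem integral_pexpDensity (hp : 0 < p) : ∫ x, pexpDensity p x = 1 := by
  obtain ⟨f, hf⟩ : ∃ f : ℝ → ℝ, f = fun y =>
      Real.exp (-(1 / p) * y ^ p) / (2 * Real.Gamma (1 / p) * p ^ (1 / p - 1)) := ⟨_, rfl⟩
  have h : ∀ x : ℝ, pexpDensity p x = f |x| := by
    intro x
    simp only [pexpDensity, hf]
    congr 2
    ring
  rw [integral_congr_ae (Eventually.of_forall h), integral_comp_abs, hf, integral_div, integral_exp_neg_mul_rpow hp (one_div_pos.2 hp),
    Real.Gamma_add_one (one_div_pos.2 hp).ne']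
  have hG := (Real.Gamma_pos_of_pos (one_div_pos.2 hp)).ne'
  have hq : (1 / p : ℝ) ^ (-1 / p) = p ^ (1 / p) := by
    rw [one_div, Real.inv_rpow hp.le, ← Real.rpow_neg hp.le]
    congr 1
    ring
  rw [hq, Real.rpow_sub hp, Real.rpow_one]
  have := (Real.rpow_pos_of_pos hp (1 / p)).ne'
  field_simp

theorem integrable_pexpDensity (hp : 0 < p) : Integrable (pexpDensity p) :=
  Integrable.of_integral_ne_zero (by rw [integral_pexpDensity hp]; exact one_ne_zero)

theorem integrable_abs_rpow_mul_pexpDensity (hp : 0 < p) {s : ℝ} (hs : 0 < s) :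
    Integrable fun x => |x| ^ s * pexpDensity p x := by
  refine Integrable.of_integral_ne_zero ?_
  obtain ⟨f, hf⟩ : ∃ f : ℝ → ℝ, f = fun y => y ^ s * Real.exp (-(1 / p) * y ^ p) /
      (2 * Real.Gamma (1 / p) * p ^ (1 / p - 1)) := ⟨_, rfl⟩
  have h : ∀ x : ℝ, |x| ^ s * pexpDensity p x = f |x| := by
    intro x
    simp only [pexpDensity, hf]
    rw [mul_div_assoc]
    congr 3
    ring
  rw [integral_congr_ae (Eventually.of_forall h), integral_comp_abs, hf, integral_div,
    integral_rpow_mul_exp_neg_mul_rpow hp (by linarith) (one_div_pos.2 hp)]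
  have := Real.Gamma_pos_of_pos (div_pos (by linarith : 0 < s + 1) hp)
  have := pexpDensity_const_pos hp
  positivity

theorem isProbabilityMeasure_pexpMeasure (hp : 0 < p) : IsProbabilityMeasure (pexpMeasure p) := by
  constructor
  rw [pexpMeasure, withDensity_apply _ MeasurableSet.univ, Measure.restrict_univ,
    ← ofReal_integral_eq_lintegral_ofReal (integrable_pexpDensity hp)
      (Eventually.of_forall fun x => (pexpDensity_pos hp x).le), integral_pexpDensity hp,
    ENNReal.ofReal_one]

theorem abs_add_rpow_add_abs_sub_rpow_le (hp : p ∈ Set.Icc (1 : ℝ) 2) (x h : ℝ) :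
    |x + h| ^ p + |x - h| ^ p ≤ 2 * (|x| ^ p + |h| ^ p) := by
  obtain ⟨hp1, hp2⟩ := hp
  have key : ∀ y : ℝ, |y| ^ p = (y ^ 2) ^ (p / 2) := by
    intro y
    rw [← sq_abs, ← Real.rpow_natCast, ← Real.rpow_mul (abs_nonneg y)]
    congr 1
    push_cast
    ring
  have hc := (Real.concaveOn_rpow (p := p / 2) (by linarith) (by linarith)).2
    (Set.mem_Ici.2 (sq_nonneg (x + h))) (Set.mem_Ici.2 (sq_nonneg (x - h)))
    (by norm_num : (0 : ℝ) ≤ 1 / 2) (by norm_num : (0 : ℝ) ≤ 1 / 2) (by norm_num)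
  simp only [smul_eq_mul] at hc
  rw [show 1 / 2 * (x + h) ^ 2 + 1 / 2 * (x - h) ^ 2 = x ^ 2 + h ^ 2 by ring] at hc
  have hs := Real.rpow_add_le_add_rpow (p := p / 2) (sq_nonneg x) (sq_nonneg h)
    (by linarith) (by linarith)
  rw [key, key, key x, key h]
  linarith

theorem pexpDensity_shift (hp : p ∈ Set.Icc (1 : ℝ) 2) (x h : ℝ) :
    Real.exp (-(|h| ^ p / p)) * pexpDensity p x ≤
      (pexpDensity p (x + h) + pexpDensity p (x - h)) / 2 := by
  have hp0 : 0 < p := by linarith [hp.1]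
  have hZ := pexpDensity_const_pos hp0
  have hA := abs_add_rpow_add_abs_sub_rpow_le hp x h
  unfold pexpDensity
  rw [← add_div, div_right_comm, ← mul_div_assoc, ← Real.exp_add]
  refine div_le_div_of_nonneg_right ?_ hZ.le
  set u := -|x + h| ^ p / p with hu
  set v := -|x - h| ^ p / p with hv
  have h1 : -(|h| ^ p / p) + -|x| ^ p / p ≤ u / 2 + v / 2 := by
    rw [hu, hv]
    field_simp
    linarith
  have h2 := Real.exp_le_exp.2 h1
  rw [Real.exp_add (u / 2)] at h2
  have h3 : Real.exp u = Real.exp (u / 2) * Real.exp (u / 2) := by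
    rw [← Real.exp_add]; congr 1; ring
  have h4 : Real.exp v = Real.exp (v / 2) * Real.exp (v / 2) := by
    rw [← Real.exp_add]; congr 1; ring
  rw [h3, h4]
  nlinarith [sq_nonneg (Real.exp (u / 2) - Real.exp (v / 2))]

/-- Anderson-type shift inequality for the `p`-exponential law on symmetric intervals. -/
theorem integral_pexpDensity_shift (hp : p ∈ Set.Icc (1 : ℝ) 2) (h : ℝ) {b : ℝ} (hb : 0 ≤ b) :
    Real.exp (-(|h| ^ p / p)) * ∫ x in (-b)..b, pexpDensity p x ≤
      ∫ x in (h - b)..(h + b), pexpDensity p x := by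
  have hp0 : 0 < p := by linarith [hp.1]
  have hcont := continuous_pexpDensity hp0
  have e1 : ∫ x in (-b)..b, pexpDensity p (x + h) = ∫ x in (h - b)..(h + b), pexpDensity p x := by
    rw [intervalIntegral.integral_comp_add_right]
    congr 1 <;> ring
  have e2 : ∫ x in (-b)..b, pexpDensity p (x - h) = ∫ x in (h - b)..(h + b), pexpDensity p x := by
    rw [← e1]
    have := intervalIntegral.integral_comp_neg (a := -b) (b := b)
      (fun x => pexpDensity p (x + h))
    rw [neg_neg] at this
    rw [← this]
    refine intervalIntegral.integral_congr fun x _ => ?_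
    rw [← pexpDensity_neg]
    congr 1
    ring
  calc Real.exp (-(|h| ^ p / p)) * ∫ x in (-b)..b, pexpDensity p x
      = ∫ x in (-b)..b, Real.exp (-(|h| ^ p / p)) * pexpDensity p x := by
        rw [intervalIntegral.integral_const_mul]
    _ ≤ ∫ x in (-b)..b, (pexpDensity p (x + h) + pexpDensity p (x - h)) / 2 := by
        refine intervalIntegral.integral_mono_on (by linarith) ?_ ?_
          fun x _ => pexpDensity_shift hp x h
        · exact (hcont.const_mul _).intervalIntegrable _ _
        · exact Continuous.intervalIntegrable (by fun_prop) _ _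
    _ = _ := by
        rw [intervalIntegral.integral_div, intervalIntegral.integral_add, e1, e2]
        · ring
        · exact Continuous.intervalIntegrable (by fun_prop) _ _
        · exact Continuous.intervalIntegrable (by fun_prop) _ _

theorem exists_mul_le_integral_pexpDensity (hp : 0 < p) :
    ∃ c : ℝ, 0 < c ∧ ∀ b : ℝ, 0 ≤ b → c * min b 1 ≤ ∫ x in (-b)..b, pexpDensity p x := by
  have hcont := continuous_pexpDensity hp
  refine ⟨2 * pexpDensity p 1, by linarith [pexpDensity_pos hp 1], fun b hb => ?_⟩
  have hm : 0 ≤ min b 1 := le_min hb zero_le_one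
  calc 2 * pexpDensity p 1 * min b 1 = ∫ _ in (-(min b 1))..(min b 1), pexpDensity p 1 := by
        rw [intervalIntegral.integral_const, smul_eq_mul]; ring
    _ ≤ ∫ x in (-(min b 1))..(min b 1), pexpDensity p x := by
        refine intervalIntegral.integral_mono_on (by linarith)
          (continuous_const.intervalIntegrable _ _) (hcont.intervalIntegrable _ _) fun x hx => ?_
        unfold pexpDensity
        have hx1 : |x| ≤ 1 := (abs_le.2 ⟨hx.1, hx.2⟩).trans (min_le_right _ _)
        have : |x| ^ p ≤ |(1 : ℝ)| ^ p := by
          rw [abs_one]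
          exact Real.rpow_le_rpow (abs_nonneg x) hx1 hp.le
        have hZ := pexpDensity_const_pos hp
        gcongr
    _ ≤ ∫ x in (-b)..b, pexpDensity p x :=
        intervalIntegral.integral_mono_interval (by linarith [min_le_left b 1]) (by linarith)
          (min_le_left b 1) (Eventually.of_forall fun x => (pexpDensity_pos hp x).le)
          (hcont.intervalIntegrable _ _)

theorem exists_one_sub_le_integral_pexpDensity (hp : 0 < p) {s : ℝ} (hs : 0 < s) :
    ∃ M : ℝ, 0 ≤ M ∧ ∀ b : ℝ, 0 < b → 1 - M * b ^ (-s) ≤ ∫ x in (-b)..b, pexpDensity p x := by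
  have hint := integrable_abs_rpow_mul_pexpDensity hp hs
  have hf := integrable_pexpDensity hp
  have hnn : ∀ x : ℝ, 0 ≤ |x| ^ s * pexpDensity p x := fun x =>
    mul_nonneg (Real.rpow_nonneg (abs_nonneg x) _) (pexpDensity_pos hp x).le
  refine ⟨∫ x, |x| ^ s * pexpDensity p x, integral_nonneg hnn, fun b hb => ?_⟩
  rw [intervalIntegral.integral_of_le (by linarith), ← integral_pexpDensity hp,
    ← integral_add_compl (measurableSet_Ioc (a := -b) (b := b)) hf, sub_le_iff_le_add]
  gcongr
  calc ∫ x in (Set.Ioc (-b) b)ᶜ, pexpDensity p x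
      ≤ ∫ x in (Set.Ioc (-b) b)ᶜ, |x| ^ s * pexpDensity p x * b ^ (-s) := by
        refine setIntegral_mono_on hf.integrableOn (hint.mul_const _).integrableOn
          measurableSet_Ioc.compl fun x hx => ?_
        have hbx : b ≤ |x| := by
          by_contra! hlt
          exact hx ⟨(abs_lt.1 hlt).1, (abs_lt.1 hlt).2.le⟩
        have h1 : 1 ≤ |x| ^ s * b ^ (-s) := by
          rw [Real.rpow_neg hb.le, ← div_eq_mul_inv, one_le_div (Real.rpow_pos_of_pos hb _)]
          exact Real.rpow_le_rpow hb.le hbx hs.le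
        nlinarith [pexpDensity_pos hp x]
    _ ≤ ∫ x, |x| ^ s * pexpDensity p x * b ^ (-s) :=
        setIntegral_le_integral (hint.mul_const _) (Eventually.of_forall fun x =>
          mul_nonneg (hnn x) (Real.rpow_nonneg hb.le _))
    _ = _ := integral_mul_const _ _

/-- A small-ball lower bound valid at all scales, with an arbitrary polynomial rate. -/
theorem exists_exp_neg_le_integral_pexpDensity (hp : 0 < p) {s : ℝ} (hs : 0 < s) :
    ∃ A : ℝ, 0 < A ∧ ∀ b : ℝ, 0 < b →
      Real.exp (-(A * b ^ (-s))) ≤ ∫ x in (-b)..b, pexpDensity p x := by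
  obtain ⟨c, hc, hcb⟩ := exists_mul_le_integral_pexpDensity hp
  obtain ⟨M, hM, hMb⟩ := exists_one_sub_le_integral_pexpDensity hp hs
  refine ⟨|Real.log c| + 1 / s + M / c, by positivity, fun b hb => ?_⟩
  have hQ := hcb b hb.le
  have hQM := hMb b hb
  set Q := ∫ x in (-b)..b, pexpDensity p x
  have hbs : 0 < b ^ (-s) := Real.rpow_pos_of_pos hb _
  have hQ0 : 0 < Q := lt_of_lt_of_le (mul_pos hc (lt_min hb one_pos)) hQ
  rw [← Real.le_log_iff_exp_le hQ0]
  rcases le_total b 1 with h | h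
  · rw [min_eq_left h] at hQ
    have h1 := Real.log_le_log (mul_pos hc hb) hQ
    rw [Real.log_mul hc.ne' hb.ne'] at h1
    have h2 := Real.log_le_rpow_div (inv_pos.2 hb).le hs
    rw [Real.log_inv, Real.inv_rpow hb.le, ← Real.rpow_neg hb.le] at h2
    have h3 : 1 ≤ b ^ (-s) := Real.one_le_rpow_of_pos_of_le_one_of_nonpos hb h (by linarith)
    have h4 := neg_abs_le (Real.log c)
    have h5 : 0 ≤ M / c * b ^ (-s) := by positivity
    have h6 : |Real.log c| ≤ |Real.log c| * b ^ (-s) :=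
      le_mul_of_one_le_right (abs_nonneg _) h3
    have h7 : b ^ (-s) / s = 1 / s * b ^ (-s) := by ring
    nlinarith
  · rw [min_eq_right h, mul_one] at hQ
    have h1 := Real.one_sub_inv_le_log_of_pos hQ0
    have h2 : Q⁻¹ - 1 ≤ M / c * b ^ (-s) := by
      have : Q⁻¹ - 1 = (1 - Q) / Q := by field_simp
      rw [this, div_mul_eq_mul_div]
      exact div_le_div₀ (by positivity) (by linarith) hc hQ
    have h3 : 0 ≤ (|Real.log c| + 1 / s) * b ^ (-s) := by positivity
    nlinarith

end Density

section Prior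

variable {p α τ : ℝ}

theorem coordLaw_Icc (hp : 0 < p) (hτ : 0 < τ) (i : ℕ) (h : ℝ) {a : ℝ} (ha : 0 ≤ a) :
    coordLaw p α τ i (Set.Icc (h - a) (h + a)) =
      ENNReal.ofReal (∫ x in (h / (τ * idx i ^ (-(1 / 2 : ℝ) - α)) -
          a / (τ * idx i ^ (-(1 / 2 : ℝ) - α)))..(h / (τ * idx i ^ (-(1 / 2 : ℝ) - α)) +
          a / (τ * idx i ^ (-(1 / 2 : ℝ) - α))), pexpDensity p x) := by
  have hσ : 0 < τ * idx i ^ (-(1 / 2 : ℝ) - α) :=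
    mul_pos hτ (Real.rpow_pos_of_pos (idx_pos i) _)
  rw [coordLaw]
  set σ := τ * idx i ^ (-(1 / 2 : ℝ) - α)
  have hpre : (fun x => σ * x) ⁻¹' Set.Icc (h - a) (h + a) =
      Set.Icc (h / σ - a / σ) (h / σ + a / σ) := by
    ext x
    simp only [Set.mem_preimage, Set.mem_Icc]
    rw [← sub_div, ← add_div, div_le_iff₀ hσ, le_div_iff₀ hσ, mul_comm]
  rw [Measure.map_apply (measurable_const_mul σ) measurableSet_Icc, hpre, pexpMeasure,
    withDensity_apply _ measurableSet_Icc,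
    ← ofReal_integral_eq_lintegral_ofReal (integrable_pexpDensity hp).integrableOn
      (Eventually.of_forall fun x => (pexpDensity_pos hp x).le),
    integral_Icc_eq_integral_Ioc, intervalIntegral.integral_of_le]
  have : 0 ≤ a / σ := by positivity
  linarith

/-- Lower bound for the prior mass of a box: product structure and continuity from above. -/
theorem IsPexpPrior.le_measure_box (hp : 0 < p) {μ : Measure (ℕ → ℝ)} (hμ : IsPexpPrior p α τ μ)
    {s : ℕ → Set ℝ} (hs : ∀ i, MeasurableSet (s i)) {g : ℕ → ℝ} {B : ℝ}
    (hg : ∀ i, ENNReal.ofReal (Real.exp (-g i)) ≤ coordLaw p α τ i (s i))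
    (hB : ∀ n, ∑ i ∈ Finset.range n, g i ≤ B) :
    ENNReal.ofReal (Real.exp (-B)) ≤ μ {θ | ∀ i, θ i ∈ s i} := by
  obtain ⟨hprob, hlim⟩ := hμ
  have := isProbabilityMeasure_pexpMeasure hp
  have hcoord : ∀ i, IsProbabilityMeasure (coordLaw p α τ i) := fun i =>
    Measure.isProbabilityMeasure_map (measurable_const_mul _).aemeasurable
  let t : ℕ → Set (ℕ → ℝ) := fun n => {θ | ∀ i ∈ Finset.range n, θ i ∈ s i}
  have ht : ∀ n, t n = (Finset.range n).restrict ⁻¹'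
      (Set.univ.pi fun i : Finset.range n => s i) := by
    intro n
    ext θ
    simp [t]
  have hmeas : ∀ n, MeasurableSet (Set.univ.pi fun i : Finset.range n => s i) := fun n =>
    MeasurableSet.univ_pi fun i => hs i
  have hmt : ∀ n, μ (t n) = ∏ i ∈ Finset.range n, coordLaw p α τ i (s i) := by
    intro n
    rw [ht, ← Measure.map_apply (Finset.measurable_restrict _) (hmeas n), hlim, Measure.pi_pi,
      Finset.prod_coe_sort (Finset.range n) fun i => coordLaw p α τ i (s i)]
  have hge : ∀ n, ENNReal.ofReal (Real.exp (-B)) ≤ μ (t n) := by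
    intro n
    rw [hmt]
    calc ENNReal.ofReal (Real.exp (-B))
        ≤ ENNReal.ofReal (∏ i ∈ Finset.range n, Real.exp (-g i)) := by
          rw [← Real.exp_sum, Finset.sum_neg_distrib]
          exact ENNReal.ofReal_le_ofReal (Real.exp_le_exp.2 (neg_le_neg (hB n)))
      _ = ∏ i ∈ Finset.range n, ENNReal.ofReal (Real.exp (-g i)) :=
          ENNReal.ofReal_prod_of_nonneg fun i _ => (Real.exp_pos _).le
      _ ≤ _ := Finset.prod_le_prod' fun i _ => hg i
  have hinter : {θ : ℕ → ℝ | ∀ i, θ i ∈ s i} = ⋂ n, t n := by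
    ext θ
    simp only [Set.mem_ofPred_eq, Set.mem_iInter, t, Finset.mem_range]
    exact ⟨fun h _ i _ => h i, fun h i => h (i + 1) i (Nat.lt_succ_self i)⟩
  rw [hinter]
  refine ge_of_tendsto' (tendsto_measure_iInter_atTop (μ := μ) (s := t) ?_ ?_ ?_) hge
  · intro n
    rw [ht]
    exact (Finset.measurable_restrict _ (hmeas n)).nullMeasurableSet
  · exact fun m n hmn θ hθ i hi => hθ i (Finset.range_mono hmn hi)
  · exact ⟨0, measure_ne_top _ _⟩

end Prior

section PowerSums

theorem sum_one_add_div_rpow_le {α R : ℝ} (hα : 0 < α) (hR : 0 < R) (n : ℕ) :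
    ∑ i ∈ Finset.range n, (1 + idx i / R) ^ (-1 - α) ≤ R / α := by
  have key : ∑ i ∈ Finset.range n, (1 + idx i / R) ^ (-1 - α) ≤
      R / α * (1 - (1 + (n : ℝ) / R) ^ (-α)) := by
    induction n with
    | zero => simp
    | succ n ih =>
      rw [Finset.sum_range_succ]
      have hx : 0 < 1 + (n : ℝ) / R := by positivity
      have hy : 0 < 1 + idx n / R := by have := idx_pos n; positivity
      have hxy : 1 + (n : ℝ) / R = (1 + idx n / R) - 1 / R := by unfold idx; ring
      push_cast
      change _ ≤ R / α * (1 - (1 + idx n / R) ^ (-α))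
      set y := 1 + idx n / R
      set x := 1 + (n : ℝ) / R
      have h1 : 1 + α * (1 - x / y) ≤ (x / y) ^ (-α) := by
        have hq : 0 < x / y := by positivity
        rw [Real.rpow_def_of_pos hq]
        have h2 := Real.add_one_le_exp (Real.log (x / y) * -α)
        have h3 := Real.log_le_sub_one_of_pos hq
        nlinarith
      rw [Real.div_rpow hx.le hy.le, le_div_iff₀ (Real.rpow_pos_of_pos hy _)] at h1
      have h4 : y ^ (-1 - α) = y ^ (-α) / y := by
        rw [show -1 - α = -α - 1 by ring, Real.rpow_sub hy, Real.rpow_one]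
      have h5 : 1 - x / y = 1 / (R * y) := by
        rw [hxy]; field_simp; ring
      rw [h5] at h1
      have h6 : y ^ (-1 - α) ≤ R / α * (x ^ (-α) - y ^ (-α)) := by
        rw [h4, div_mul_eq_mul_div, le_div_iff₀ hα]
        calc y ^ (-α) / y * α = R * ((1 + α * (1 / (R * y))) * y ^ (-α) - y ^ (-α)) := by
              field_simp; ring
          _ ≤ _ := by gcongr
      linarith
  refine key.trans (mul_le_of_le_one_right (by positivity) ?_)
  have : 0 ≤ (1 + (n : ℝ) / R) ^ (-α) := by positivity
  linarith

theorem sum_rpow_mul_one_add_rpow_le {R : ℝ} (hR : 0 < R) (n : ℕ) :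
    ∑ i ∈ Finset.range n, (idx i / R) ^ (-(1 / 2) : ℝ) * (1 + idx i / R) ^ (-(3 / 2) : ℝ) ≤
      2 * R := by
  have key : ∑ i ∈ Finset.range n,
      (idx i / R) ^ (-(1 / 2) : ℝ) * (1 + idx i / R) ^ (-(3 / 2) : ℝ) ≤
      2 * R * Real.sqrt ((n / R) / (1 + (n : ℝ) / R)) := by
    induction n with
    | zero => simp
    | succ n ih =>
      rw [Finset.sum_range_succ]
      push_cast
      change _ ≤ 2 * R * Real.sqrt ((idx n / R) / (1 + idx n / R))
      have hr : 0 < idx n / R := div_pos (idx_pos n) hR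
      have hr' : 0 ≤ (n : ℝ) / R := by positivity
      have hd : (n : ℝ) / R = idx n / R - 1 / R := by unfold idx; ring
      set r := idx n / R
      set r' := (n : ℝ) / R
      have hA : 0 < r / (1 + r) := by positivity
      have hB : 0 ≤ r' / (1 + r') := by positivity
      have hAB : 1 / R / (1 + r) ^ 2 ≤ r / (1 + r) - r' / (1 + r') := by
        have : r / (1 + r) - r' / (1 + r') = 1 / R / ((1 + r) * (1 + r')) := by
          rw [show (1 : ℝ) / R = r - r' by rw [hd]; ring]
          field_simp
          ring
        rw [this]
        have hle : r' ≤ r := by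
          rw [hd]
          have : 0 < 1 / R := by positivity
          linarith
        have : (1 + r) * (1 + r') ≤ (1 + r) ^ 2 := by nlinarith
        gcongr
      have hg : r ^ (-(1 / 2) : ℝ) * (1 + r) ^ (-(3 / 2) : ℝ) =
          1 / (Real.sqrt (r / (1 + r)) * (1 + r) ^ 2) := by
        have h1r : 0 < 1 + r := by positivity
        rw [Real.sqrt_eq_rpow, Real.div_rpow hr.le h1r.le, Real.rpow_neg hr.le,
          Real.rpow_neg h1r.le, ← Real.rpow_natCast,
          show (3 / 2 : ℝ) = ((2 : ℕ) : ℝ) - 1 / 2 by norm_num, Real.rpow_sub h1r]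
        field_simp
      rw [hg]
      have hsA := Real.sqrt_pos.2 hA
      have hA2 := Real.sq_sqrt hA.le
      have hB2 := Real.sq_sqrt hB
      set a := Real.sqrt (r / (1 + r))
      set b := Real.sqrt (r' / (1 + r'))
      have h1 : 1 / R / (1 + r) ^ 2 ≤ 2 * a * (a - b) := by nlinarith [sq_nonneg (a - b)]
      have h2 : 1 / (a * (1 + r) ^ 2) ≤ 2 * R * (a - b) := by
        calc 1 / (a * (1 + r) ^ 2) = R / a * (1 / R / (1 + r) ^ 2) := by field_simp
          _ ≤ R / a * (2 * a * (a - b)) := by gcongr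
          _ = _ := by field_simp
      linarith
  refine key.trans (mul_le_of_le_one_right (by positivity) ?_)
  refine Real.sqrt_le_iff.2 ⟨zero_le_one, ?_⟩
  rw [one_pow]
  exact div_le_one_of_le₀ (by linarith) (by positivity)

theorem exists_sum_idx_rpow_le {q : ℝ} (hq : -1 < q) :
    ∃ C : ℝ, 0 < C ∧ ∀ J : ℕ, ∑ i ∈ Finset.range J, idx i ^ q ≤ C * (J : ℝ) ^ (q + 1) := by
  rcases le_or_gt 0 q with h0 | h0
  · refine ⟨1, one_pos, fun J => ?_⟩
    rcases Nat.eq_zero_or_pos J with rfl | hJ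
    · simp [Real.rpow_nonneg]
    have hJ0 : (0 : ℝ) < J := by exact_mod_cast hJ
    rw [one_mul, Real.rpow_add_one hJ0.ne', mul_comm]
    have : ∀ i ∈ Finset.range J, idx i ^ q ≤ (J : ℝ) ^ q := by
      intro i hi
      refine Real.rpow_le_rpow (idx_pos i).le ?_ h0
      unfold idx
      exact_mod_cast Finset.mem_range.1 hi
    simpa using Finset.sum_le_sum this
  · refine ⟨1 / (q + 1), by apply one_div_pos.2; linarith, fun J => ?_⟩
    have ht : 0 < q + 1 := by linarith
    induction J with
    | zero => simp [Real.zero_rpow ht.ne']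
    | succ n ih =>
      rw [Finset.sum_range_succ]
      push_cast
      change _ ≤ 1 / (q + 1) * idx n ^ (q + 1)
      have hx := idx_pos n
      have h1 := rpow_one_add_le_one_add_mul_self (s := -(1 / idx n))
        (by have := one_le_idx n; rw [neg_le_neg_iff, div_le_one hx]; exact this)
        ht.le (by linarith : q + 1 ≤ 1)
      have h2 : 1 + -(1 / idx n) = n / idx n := by
        field_simp
        unfold idx
        ring
      rw [h2, Real.div_rpow n.cast_nonneg hx.le,
        div_le_iff₀ (Real.rpow_pos_of_pos hx _)] at h1
      have h3 : idx n ^ (q + 1) / idx n = idx n ^ q := by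
        rw [Real.rpow_add_one hx.ne']
        field_simp
      have h4 : (1 + (q + 1) * -(1 / idx n)) * idx n ^ (q + 1) =
          idx n ^ (q + 1) - (q + 1) * idx n ^ q := by
        rw [← h3]; ring
      rw [h4] at h1
      have h5 : idx n ^ q ≤ 1 / (q + 1) * (idx n ^ (q + 1) - (n : ℝ) ^ (q + 1)) := by
        rw [one_div, ← div_eq_inv_mul, le_div_iff₀ ht]
        linarith
      linarith

theorem exists_sum_idx_rpow_le_const {q : ℝ} (hq : q < -1) :
    ∃ C : ℝ, 0 < C ∧ ∀ J : ℕ, ∑ i ∈ Finset.range J, idx i ^ q ≤ C := by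
  have hs : Summable fun i : ℕ => idx i ^ q := by
    have := (summable_nat_add_iff 1).2 (Real.summable_nat_rpow.2 hq)
    simpa [idx] using this
  have hnn : ∀ i, 0 ≤ idx i ^ q := fun i => Real.rpow_nonneg (idx_pos i).le _
  exact ⟨|∑' i, idx i ^ q| + 1, by positivity, fun J => by
    linarith [hs.sum_le_tsum (Finset.range J) fun i _ => hnn i, le_abs_self (∑' i, idx i ^ q)]⟩

theorem sum_idx_rpow_neg_one_le (J : ℕ) :
    ∑ i ∈ Finset.range J, idx i ^ (-1 : ℝ) ≤ 1 + Real.log J := by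
  refine le_trans (le_of_eq ?_) (harmonic_le_one_add_log J)
  simp [harmonic, idx, Real.rpow_neg_one]

end PowerSums

section SobolevSums

theorem inSobolevBall.sum_le {β L : ℝ} {θ : ℕ → ℝ} (h : inSobolevBall β L θ) (hL : 0 ≤ L)
    (s : Finset ℕ) : ∑ i ∈ s, idx i ^ (2 * β) * θ i ^ 2 ≤ L ^ 2 := by
  have hnn : ∀ i, 0 ≤ idx i ^ (2 * β) * θ i ^ 2 := fun i =>
    mul_nonneg (Real.rpow_nonneg (idx_pos i).le _) (sq_nonneg _)
  exact (h.1.sum_le_tsum s fun i _ => hnn i).trans ((Real.sqrt_le_left hL).1 h.2)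

/-- Growth in `J` of the prior energy of the first `J` coordinates of an element of a Sobolev
ball. -/
def sobolevEnergyRate (p α β : ℝ) (J : ℕ) : ℝ :=
  if β < α + 1 / p then (J : ℝ) ^ (1 + p * (α - β))
  else if α + 1 / p < β then 1
  else (1 + Real.log J) ^ (1 - p / 2)

theorem sum_idx_rpow_mul_abs_rpow_le {p : ℝ} (hp1 : 1 ≤ p) (hp2 : p < 2) (α : ℝ) {β L : ℝ}
    (hL : 0 < L) {θ : ℕ → ℝ} (hθ : inSobolevBall β L θ) (J : ℕ) :
    ∑ i ∈ Finset.range J, idx i ^ (p * (1 / 2 + α)) * |θ i| ^ p ≤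
      L ^ p * (∑ i ∈ Finset.range J, idx i ^ (2 * p * (1 / 2 + α - β) / (2 - p))) ^
        (1 - p / 2) := by
  have hp0 : 0 < p := by linarith
  have h2p : 0 < 2 - p := by linarith
  have hconj : (2 / p).HolderConjugate (2 / (2 - p)) := by
    rw [Real.holderConjugate_iff]
    refine ⟨by rw [lt_div_iff₀ hp0]; linarith, ?_⟩
    field_simp
    ring
  have hH := Real.inner_le_Lp_mul_Lq (Finset.range J)
    (fun i => idx i ^ (p * β) * |θ i| ^ p) (fun i => idx i ^ (p * (1 / 2 + α - β))) hconj
  have e1 : ∀ i, idx i ^ (p * β) * |θ i| ^ p * idx i ^ (p * (1 / 2 + α - β)) =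
      idx i ^ (p * (1 / 2 + α)) * |θ i| ^ p := by
    intro i
    rw [mul_right_comm, ← Real.rpow_add (idx_pos i)]
    congr 2
    ring
  have e2 : ∀ i, |idx i ^ (p * β) * |θ i| ^ p| ^ (2 / p) = idx i ^ (2 * β) * θ i ^ 2 := by
    intro i
    have hi := (idx_pos i).le
    rw [abs_of_nonneg (mul_nonneg (Real.rpow_nonneg hi _) (Real.rpow_nonneg (abs_nonneg _) _)),
      Real.mul_rpow (Real.rpow_nonneg hi _) (Real.rpow_nonneg (abs_nonneg _) _),
      ← Real.rpow_mul hi, ← Real.rpow_mul (abs_nonneg _), ← sq_abs (θ i), ← Real.rpow_natCast]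
    congr 2
    · field_simp
    · push_cast
      field_simp
  have e3 : ∀ i, |idx i ^ (p * (1 / 2 + α - β))| ^ (2 / (2 - p)) =
      idx i ^ (2 * p * (1 / 2 + α - β) / (2 - p)) := by
    intro i
    have hi := (idx_pos i).le
    rw [abs_of_nonneg (Real.rpow_nonneg hi _), ← Real.rpow_mul hi]
    congr 1
    ring
  simp only [e1, e2, e3] at hH
  rw [show 1 / (2 / (2 - p)) = 1 - p / 2 by field_simp] at hH
  refine hH.trans (mul_le_mul_of_nonneg_right ?_ (Real.rpow_nonneg
    (Finset.sum_nonneg fun i _ => Real.rpow_nonneg (idx_pos i).le _) _))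
  have hL2 : L ^ p = (L ^ 2) ^ (1 / (2 / p)) := by
    rw [← Real.rpow_natCast, ← Real.rpow_mul hL.le]
    congr 1
    push_cast
    field_simp
  rw [hL2]
  refine Real.rpow_le_rpow (Finset.sum_nonneg fun i _ =>
    mul_nonneg (Real.rpow_nonneg (idx_pos i).le _) (sq_nonneg _)) (hθ.sum_le hL.le _) ?_
  positivity

theorem exists_sum_le_sobolevEnergyRate {p : ℝ} (hp : p ∈ Set.Icc (1 : ℝ) 2) (α β : ℝ) {L : ℝ}
    (hL : 0 < L) :
    ∃ C : ℝ, 0 < C ∧ ∀ θ : ℕ → ℝ, inSobolevBall β L θ → ∀ J : ℕ,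
      ∑ i ∈ Finset.range J, idx i ^ (p * (1 / 2 + α)) * |θ i| ^ p ≤
        C * sobolevEnergyRate p α β J := by
  obtain ⟨hp1, hp2⟩ := hp
  have hp0 : 0 < p := by linarith
  have hpp : p * (1 / p) = 1 := by field_simp
  rcases hp2.lt_or_eq with hp2 | rfl
  · have h2p : 0 < 2 - p := by linarith
    set q := 2 * p * (1 / 2 + α - β) / (2 - p) with hq
    have hq1 : q + 1 = 2 * (1 + p * (α - β)) / (2 - p) := by rw [hq]; field_simp; ring
    have hpow : 0 ≤ 1 - p / 2 := by linarith
    have hnn : ∀ J, 0 ≤ ∑ i ∈ Finset.range J, idx i ^ q := fun J =>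
      Finset.sum_nonneg fun i _ => Real.rpow_nonneg (idx_pos i).le _
    have hLp : 0 < L ^ p := Real.rpow_pos_of_pos hL p
    suffices ∃ C : ℝ, 0 < C ∧ ∀ J : ℕ, (∑ i ∈ Finset.range J, idx i ^ q) ^ (1 - p / 2) ≤
        C * sobolevEnergyRate p α β J by
      obtain ⟨C, hC, h⟩ := this
      refine ⟨L ^ p * C, by positivity, fun θ hθ J => ?_⟩
      refine (sum_idx_rpow_mul_abs_rpow_le hp1 hp2 α hL hθ J).trans ?_
      rw [mul_assoc (L ^ p) C]
      exact mul_le_mul_of_nonneg_left (h J) hLp.le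
    unfold sobolevEnergyRate
    rcases lt_trichotomy β (α + 1 / p) with h | h | h
    · have he : 0 < 1 + p * (α - β) := by nlinarith
      have hqq : -1 < q := by
        have : 0 < q + 1 := by rw [hq1]; positivity
        linarith
      obtain ⟨C, hC, hCJ⟩ := exists_sum_idx_rpow_le hqq
      refine ⟨C ^ (1 - p / 2), by positivity, fun J => ?_⟩
      rw [if_pos h]
      refine (Real.rpow_le_rpow (hnn J) (hCJ J) hpow).trans (le_of_eq ?_)
      rw [Real.mul_rpow hC.le (by positivity), ← Real.rpow_mul J.cast_nonneg, hq1]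
      congr 2
      field_simp
    · have he : 1 + p * (α - β) = 0 := by rw [h]; nlinarith
      have hqq : q = -1 := by
        have : q + 1 = 0 := by rw [hq1, he]; simp
        linarith
      refine ⟨1, one_pos, fun J => ?_⟩
      rw [if_neg h.not_lt, if_neg h.symm.not_lt, one_mul]
      refine Real.rpow_le_rpow (hnn J) ?_ hpow
      rw [hqq]
      exact sum_idx_rpow_neg_one_le J
    · have he : 1 + p * (α - β) < 0 := by nlinarith
      have hqq : q < -1 := by
        have : q + 1 < 0 := by rw [hq1]; exact div_neg_of_neg_of_pos (by linarith) h2p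
        linarith
      obtain ⟨C, hC, hCJ⟩ := exists_sum_idx_rpow_le_const hqq
      refine ⟨C ^ (1 - p / 2), by positivity, fun J => ?_⟩
      rw [if_neg h.not_gt, if_pos h, mul_one]
      exact Real.rpow_le_rpow (hnn J) (hCJ J) hpow
  · have hterm : ∀ (θ : ℕ → ℝ) (i : ℕ), idx i ^ (2 * (1 / 2 + α)) * |θ i| ^ (2 : ℝ) =
        idx i ^ (2 * β) * θ i ^ 2 * idx i ^ (1 + 2 * (α - β)) := by
      intro θ i
      rw [mul_right_comm, ← Real.rpow_add (idx_pos i), ← sq_abs (θ i), ← Real.rpow_natCast]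
      congr 2
      ring
    have hnn : ∀ (θ : ℕ → ℝ) (i : ℕ), 0 ≤ idx i ^ (2 * β) * θ i ^ 2 := fun θ i =>
      mul_nonneg (Real.rpow_nonneg (idx_pos i).le _) (sq_nonneg _)
    refine ⟨L ^ 2, by positivity, fun θ hθ J => ?_⟩
    have hle : ∀ i ∈ Finset.range J,
        idx i ^ (1 + 2 * (α - β)) ≤ sobolevEnergyRate 2 α β J := by
      intro i hi
      unfold sobolevEnergyRate
      split_ifs with h1 h2
      · refine Real.rpow_le_rpow (idx_pos i).le ?_ (by nlinarith)
        unfold idx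
        exact_mod_cast Finset.mem_range.1 hi
      · exact Real.rpow_le_one_of_one_le_of_nonpos (one_le_idx i) (by linarith)
      · rw [show (1 : ℝ) - 2 / 2 = 0 by norm_num, Real.rpow_zero]
        exact Real.rpow_le_one_of_one_le_of_nonpos (one_le_idx i) (by linarith)
    calc ∑ i ∈ Finset.range J, idx i ^ (2 * (1 / 2 + α)) * |θ i| ^ (2 : ℝ)
        ≤ ∑ i ∈ Finset.range J, idx i ^ (2 * β) * θ i ^ 2 * sobolevEnergyRate 2 α β J := by
          refine Finset.sum_le_sum fun i hi => ?_
          rw [hterm]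
          exact mul_le_mul_of_nonneg_left (hle i hi) (hnn θ i)
      _ = (∑ i ∈ Finset.range J, idx i ^ (2 * β) * θ i ^ 2) * sobolevEnergyRate 2 α β J := by
          rw [Finset.sum_mul]
      _ ≤ L ^ 2 * sobolevEnergyRate 2 α β J := by
          rcases Nat.eq_zero_or_pos J with rfl | hJ
          · simp only [Finset.range_zero, Finset.sum_empty, zero_mul]
            unfold sobolevEnergyRate
            split_ifs <;> simp <;> positivity
          · have h0 : 0 ≤ sobolevEnergyRate 2 α β J :=
              (Real.rpow_nonneg (idx_pos 0).le _).trans (hle 0 (Finset.mem_range.2 hJ))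
            exact mul_le_mul_of_nonneg_right (hθ.sum_le hL.le _) h0

end SobolevSums

section SmallBall

theorem exists_exp_neg_le_integral_profile {p α : ℝ} (hp : 0 < p) (hα : 0 < α) :
    ∃ A : ℝ, 0 < A ∧ ∀ r b : ℝ, 0 < r →
      b = r ^ (α + 1 / 2) * (1 + r) ^ (-((1 + α) / 2)) →
      Real.exp (-(A * (r ^ (-(1 / 2) : ℝ) * (1 + r) ^ (-(3 / 2) : ℝ)))) ≤
        ∫ x in (-b)..b, pexpDensity p x := by
  obtain ⟨A₁, hA₁, h₁⟩ := exists_exp_neg_le_integral_pexpDensity hp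
    (by positivity : 0 < 1 / (1 + 2 * α))
  obtain ⟨A₂, hA₂, h₂⟩ := exists_exp_neg_le_integral_pexpDensity hp
    (by positivity : 0 < 4 / α)
  refine ⟨A₁ * 4 + A₂ * 2 ^ (7 / 2 + 2 / α), by positivity, fun r b hr hb => ?_⟩
  have hr1 : 0 < 1 + r := by linarith
  have hb0 : 0 < b := by rw [hb]; positivity
  have hg : 0 < r ^ (-(1 / 2) : ℝ) * (1 + r) ^ (-(3 / 2) : ℝ) := by positivity
  have hbs : ∀ s : ℝ, b ^ (-s) = r ^ (-(s * (α + 1 / 2))) * (1 + r) ^ (s * ((1 + α) / 2)) := by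
    intro s
    rw [hb, Real.mul_rpow (by positivity) (by positivity), ← Real.rpow_mul hr.le,
      ← Real.rpow_mul hr1.le]
    congr 2 <;> ring
  rcases le_total r 1 with h | h
  · refine le_trans (Real.exp_le_exp.2 (neg_le_neg ?_)) (h₁ b hb0)
    have hk : b ^ (-(1 / (1 + 2 * α))) ≤
        4 * (r ^ (-(1 / 2) : ℝ) * (1 + r) ^ (-(3 / 2) : ℝ)) := by
      rw [hbs, show 1 / (1 + 2 * α) * (α + 1 / 2) = 1 / 2 by field_simp; ring, mul_left_comm]
      refine mul_le_mul_of_nonneg_left ?_ (by positivity)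
      calc (1 + r) ^ (1 / (1 + 2 * α) * ((1 + α) / 2)) ≤ (1 + r) ^ (1 / 2 : ℝ) := by
            refine Real.rpow_le_rpow_of_exponent_le (by linarith) ?_
            rw [div_mul_div_comm, div_le_div_iff₀ (by positivity) (by norm_num)]
            linarith
        _ = (1 + r) ^ (2 : ℝ) * (1 + r) ^ (-(3 / 2) : ℝ) := by
            rw [← Real.rpow_add hr1]; norm_num
        _ ≤ 4 * (1 + r) ^ (-(3 / 2) : ℝ) := by
            refine mul_le_mul_of_nonneg_right ?_ (by positivity)
            rw [Real.rpow_two]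
            nlinarith
    have : 0 ≤ A₂ * 2 ^ (7 / 2 + 2 / α) * (r ^ (-(1 / 2) : ℝ) * (1 + r) ^ (-(3 / 2) : ℝ)) := by
      positivity
    nlinarith
  · refine le_trans (Real.exp_le_exp.2 (neg_le_neg ?_)) (h₂ b hb0)
    have hk : b ^ (-(4 / α)) ≤
        2 ^ (7 / 2 + 2 / α) * (r ^ (-(1 / 2) : ℝ) * (1 + r) ^ (-(3 / 2) : ℝ)) := by
      rw [hbs, show -(4 / α * (α + 1 / 2)) = -(1 / 2) + -(7 / 2 + 2 / α) by field_simp; ring,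
        Real.rpow_add hr, mul_left_comm, mul_assoc]
      refine mul_le_mul_of_nonneg_left ?_ (by positivity)
      have hk0 : 0 < 7 / 2 + 2 / α := by positivity
      have hexp : (1 + r) ^ (4 / α * ((1 + α) / 2)) =
          (1 + r) ^ (7 / 2 + 2 / α) * (1 + r) ^ (-(3 / 2) : ℝ) := by
        rw [← Real.rpow_add hr1]
        congr 1
        field_simp
        ring
      rw [hexp, ← mul_assoc]
      refine mul_le_mul_of_nonneg_right ?_ (by positivity)
      rw [Real.rpow_neg hr.le, inv_mul_le_iff₀ (by positivity), ← Real.mul_rpow hr.le (by norm_num)]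
      exact Real.rpow_le_rpow hr1.le (by linarith) hk0.le
    have : 0 ≤ A₁ * 4 * (r ^ (-(1 / 2) : ℝ) * (1 + r) ^ (-(3 / 2) : ℝ)) := by
      positivity
    nlinarith

end SmallBall

section PriorSmallBall

variable {p α : ℝ}

/-- Mass that one coordinate of the prior gives to an interval of the profile width centred
at `h`. -/
theorem ofReal_exp_neg_le_coordLaw (hp : p ∈ Set.Icc (1 : ℝ) 2) {A : ℝ}
    (hA : ∀ r b : ℝ, 0 < r → b = r ^ (α + 1 / 2) * (1 + r) ^ (-((1 + α) / 2)) →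
      Real.exp (-(A * (r ^ (-(1 / 2) : ℝ) * (1 + r) ^ (-(3 / 2) : ℝ)))) ≤
        ∫ x in (-b)..b, pexpDensity p x)
    {τ R : ℝ} (hτ : 0 < τ) (hR : 0 < R) (i : ℕ) (h : ℝ) {a : ℝ}
    (ha : a = τ * R ^ (-(1 / 2) - α) * (1 + idx i / R) ^ (-((1 + α) / 2))) :
    ENNReal.ofReal (Real.exp (-(τ ^ (-p) * (idx i ^ (p * (1 / 2 + α)) * |h| ^ p) / p +
      A * ((idx i / R) ^ (-(1 / 2) : ℝ) * (1 + idx i / R) ^ (-(3 / 2) : ℝ))))) ≤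
        coordLaw p α τ i (Set.Icc (h - a) (h + a)) := by
  have hp0 : 0 < p := by linarith [hp.1]
  have hi := idx_pos i
  have hr : 0 < idx i / R := div_pos hi hR
  have hr1 : 0 < 1 + idx i / R := by linarith
  have ha0 : 0 ≤ a := by rw [ha]; positivity
  rw [coordLaw_Icc hp0 hτ i h ha0]
  refine ENNReal.ofReal_le_ofReal ?_
  have hσ : 0 < τ * idx i ^ (-(1 / 2 : ℝ) - α) := by positivity
  have hb : a / (τ * idx i ^ (-(1 / 2 : ℝ) - α)) =
      (idx i / R) ^ (α + 1 / 2) * (1 + idx i / R) ^ (-((1 + α) / 2)) := by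
    rw [ha, div_eq_iff hσ.ne', Real.div_rpow hi.le hR.le,
      show -(1 / 2 : ℝ) - α = -(α + 1 / 2) by ring, Real.rpow_neg hi.le, Real.rpow_neg hR.le]
    have := Real.rpow_pos_of_pos hi (α + 1 / 2)
    field_simp
  have hh : |h / (τ * idx i ^ (-(1 / 2 : ℝ) - α))| ^ p =
      τ ^ (-p) * (idx i ^ (p * (1 / 2 + α)) * |h| ^ p) := by
    rw [abs_div, abs_of_pos hσ, Real.div_rpow (abs_nonneg _) hσ.le,
      Real.mul_rpow hτ.le (by positivity), ← Real.rpow_mul hi.le,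
      show (-(1 / 2 : ℝ) - α) * p = -(p * (1 / 2 + α)) by ring, Real.rpow_neg hi.le,
      Real.rpow_neg hτ.le]
    have := Real.rpow_pos_of_pos hi (p * (1 / 2 + α))
    have := Real.rpow_pos_of_pos hτ p
    field_simp
  have hshift := integral_pexpDensity_shift hp (h / (τ * idx i ^ (-(1 / 2 : ℝ) - α)))
    (b := a / (τ * idx i ^ (-(1 / 2 : ℝ) - α))) (by positivity)
  refine le_trans ?_ hshift
  rw [hh, neg_add, Real.exp_add]
  exact mul_le_mul_of_nonneg_left (hA _ _ hr hb) (Real.exp_pos _).le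

theorem l2norm_sub_le_of_box {β L K ε : ℝ} (hL : 0 ≤ L) (hKε : 0 < K * ε) {θ θ₀ a : ℕ → ℝ}
    (hθ₀ : inSobolevBall β L θ₀) (hβ : 0 < β) {J : ℕ}
    (hJ : (2 * L / (K * ε)) ^ (1 / β) ≤ J + 1)
    (ha : ∀ n, ∑ i ∈ Finset.range n, a i ^ 2 ≤ (K * ε) ^ 2 / 4)
    (hθ : ∀ i, |θ i - if i < J then θ₀ i else 0| ≤ a i) :
    l2norm (fun i => θ i - θ₀ i) ≤ K * ε := by
  refine Real.sqrt_le_iff.2 ⟨hKε.le, ?_⟩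
  refine Real.tsum_le_of_sum_range_le (fun i => sq_nonneg _) fun n => ?_
  have hJ1 : (0 : ℝ) < J + 1 := by positivity
  have hX : (2 * L / (K * ε)) ^ 2 ≤ ((J : ℝ) + 1) ^ (2 * β) := by
    have h1 := Real.rpow_le_rpow (by positivity) hJ (by positivity : 0 ≤ 2 * β)
    rwa [← Real.rpow_mul (by positivity), show 1 / β * (2 * β) = (2 : ℕ) by
      push_cast; field_simp, Real.rpow_natCast] at h1
  set T := ((J : ℝ) + 1) ^ (2 * β)
  have hT : 0 < T := Real.rpow_pos_of_pos hJ1 _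
  have hterm : ∀ i, (θ i - θ₀ i) ^ 2 ≤
      2 * a i ^ 2 + 2 * (idx i ^ (2 * β) * θ₀ i ^ 2) / T := by
    intro i
    have hnn : 0 ≤ idx i ^ (2 * β) * θ₀ i ^ 2 :=
      mul_nonneg (Real.rpow_nonneg (idx_pos i).le _) (sq_nonneg _)
    have h1 := hθ i
    have h2 := sq_le_sq' (by linarith [abs_nonneg (θ i - if i < J then θ₀ i else 0)]) h1
    rw [sq_abs] at h2
    split_ifs at h2 with hiJ
    · have : 0 ≤ 2 * (idx i ^ (2 * β) * θ₀ i ^ 2) / T := by positivity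
      nlinarith [sq_nonneg (a i)]
    · have h3 : T ≤ idx i ^ (2 * β) := by
        refine Real.rpow_le_rpow hJ1.le ?_ (by positivity)
        unfold idx
        have : (J : ℝ) ≤ i := by exact_mod_cast not_lt.1 hiJ
        linarith
      have h4 : 2 * θ₀ i ^ 2 ≤ 2 * (idx i ^ (2 * β) * θ₀ i ^ 2) / T := by
        rw [le_div_iff₀ hT]
        nlinarith [sq_nonneg (θ₀ i)]
      nlinarith [sq_nonneg (θ i + θ₀ i)]
  calc ∑ i ∈ Finset.range n, (θ i - θ₀ i) ^ 2
      ≤ ∑ i ∈ Finset.range n, (2 * a i ^ 2 + 2 * (idx i ^ (2 * β) * θ₀ i ^ 2) / T) :=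
        Finset.sum_le_sum fun i _ => hterm i
    _ = 2 * ∑ i ∈ Finset.range n, a i ^ 2 +
          2 * (∑ i ∈ Finset.range n, idx i ^ (2 * β) * θ₀ i ^ 2) / T := by
        rw [Finset.sum_add_distrib, ← Finset.mul_sum, ← Finset.sum_div, ← Finset.mul_sum]
    _ ≤ 2 * ((K * ε) ^ 2 / 4) + 2 * L ^ 2 / T := by
        have := hθ₀.sum_le hL (Finset.range n)
        have := ha n
        gcongr
    _ ≤ (K * ε) ^ 2 := by
        have : 2 * L ^ 2 / T ≤ (K * ε) ^ 2 / 2 := by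
          rw [div_le_iff₀ hT]
          have h5 : (2 * L / (K * ε)) ^ 2 * (K * ε) ^ 2 = 4 * L ^ 2 := by
            rw [← mul_pow, div_mul_cancel₀ _ hKε.ne']
            ring
          have h6 := mul_le_mul_of_nonneg_right hX (sq_nonneg (K * ε))
          nlinarith
        linarith

/-- Lower bound for the prior mass of a ball around a Sobolev truth: the centred small ball
exponent plus the energy of the truncated truth. -/
theorem exists_le_prior_ball (hp : p ∈ Set.Icc (1 : ℝ) 2) (hα : 0 < α) {β K L : ℝ} (hβ : 0 < β)
    (hK : 0 < K) (hL : 0 < L) :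
    ∃ C₁ C₂ : ℝ, 0 < C₁ ∧ 0 < C₂ ∧ ∀ θ₀ : ℕ → ℝ, inSobolevBall β L θ₀ →
      ∀ (τ ε : ℝ) (J : ℕ) (μ : Measure (ℕ → ℝ)), 0 < τ → 0 < ε → IsPexpPrior p α τ μ →
        (2 * L / (K * ε)) ^ (1 / β) ≤ J + 1 →
        ENNReal.ofReal (Real.exp (-(C₁ * (τ / ε) ^ (1 / α) +
          C₂ * (τ ^ (-p) * sobolevEnergyRate p α β J)))) ≤
          μ {θ | l2norm (fun i => θ i - θ₀ i) ≤ K * ε} := by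
  have hp0 : 0 < p := by linarith [hp.1]
  obtain ⟨A, hA, hAr⟩ := exists_exp_neg_le_integral_profile hp0 hα
  obtain ⟨S, hS, hSJ⟩ := exists_sum_le_sobolevEnergyRate hp α β hL
  set D := 2 / (K * Real.sqrt α) with hD
  have hsα := Real.sqrt_pos.2 hα
  have hD0 : 0 < D := by positivity
  refine ⟨A * (2 * D ^ (1 / α)), S / p, by positivity, by positivity, ?_⟩
  intro θ₀ hθ₀ τ ε J μ hτ hε hμ hJ
  set R := (D * (τ / ε)) ^ (1 / α) with hRdef
  have hR : 0 < R := by positivity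
  let h : ℕ → ℝ := fun i => if i < J then θ₀ i else 0
  let a : ℕ → ℝ := fun i => τ * R ^ (-(1 / 2) - α) * (1 + idx i / R) ^ (-((1 + α) / 2))
  have ha2 : ∀ i, a i ^ 2 = τ ^ 2 * R ^ (-1 - 2 * α) * (1 + idx i / R) ^ (-1 - α) := by
    intro i
    have hr1 : 0 ≤ 1 + idx i / R := by have := idx_pos i; positivity
    simp only [a]
    rw [mul_pow, mul_pow, ← Real.rpow_mul_natCast hR.le, ← Real.rpow_mul_natCast hr1]
    congr 2
    · congr 1; push_cast; ring
    · push_cast; ring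
  have hasum : ∀ n, ∑ i ∈ Finset.range n, a i ^ 2 ≤ (K * ε) ^ 2 / 4 := by
    intro n
    simp only [ha2]
    rw [← Finset.mul_sum]
    refine (mul_le_mul_of_nonneg_left (sum_one_add_div_rpow_le hα hR n)
      (by positivity)).trans (le_of_eq ?_)
    have h1 : R ^ (-1 - 2 * α) * R = (D * (τ / ε)) ^ (-2 : ℝ) := by
      rw [← Real.rpow_add_one hR.ne', hRdef, ← Real.rpow_mul (by positivity)]
      congr 1
      field_simp
      ring
    rw [mul_div_assoc', mul_assoc, h1, Real.rpow_neg (by positivity), Real.rpow_two, hD]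
    have h2 := Real.sq_sqrt hα.le
    rw [mul_pow, div_pow, mul_pow, h2]
    field_simp
    norm_num
  refine le_trans ?_ (measure_mono (μ := μ) (s := {θ | ∀ i, θ i ∈ Set.Icc (h i - a i) (h i + a i)})
    fun θ hθ => ?_)
  · refine hμ.le_measure_box hp0 (fun i => measurableSet_Icc)
      (fun i => ofReal_exp_neg_le_coordLaw hp hAr hτ hR i (h i) rfl) fun n => ?_
    rw [Finset.sum_add_distrib, ← Finset.sum_div, ← Finset.mul_sum, ← Finset.mul_sum, add_comm]
    refine add_le_add ?_ ?_
    · refine (mul_le_mul_of_nonneg_left (sum_rpow_mul_one_add_rpow_le hR n) hA.le).trans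
        (le_of_eq ?_)
      rw [hRdef, Real.mul_rpow hD0.le (by positivity)]
      ring
    · have hsum : ∑ i ∈ Finset.range n, idx i ^ (p * (1 / 2 + α)) * |h i| ^ p ≤
          S * sobolevEnergyRate p α β J := by
        have hle : ∑ i ∈ Finset.range n, idx i ^ (p * (1 / 2 + α)) * |h i| ^ p =
            ∑ i ∈ (Finset.range n).filter (· < J), idx i ^ (p * (1 / 2 + α)) * |θ₀ i| ^ p := by
          rw [Finset.sum_filter]
          refine Finset.sum_congr rfl fun i _ => ?_
          simp only [h]
          split_ifs
          · rfl
          · simp [Real.zero_rpow hp0.ne']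
        rw [hle]
        refine (Finset.sum_le_sum_of_subset_of_nonneg ?_ fun i _ _ => mul_nonneg
          (Real.rpow_nonneg (idx_pos i).le _) (Real.rpow_nonneg (abs_nonneg _) _)).trans
          (hSJ θ₀ hθ₀ J)
        intro i hi
        exact Finset.mem_range.2 (Finset.mem_filter.1 hi).2
      calc τ ^ (-p) * (∑ i ∈ Finset.range n, idx i ^ (p * (1 / 2 + α)) * |h i| ^ p) / p
          ≤ τ ^ (-p) * (S * sobolevEnergyRate p α β J) / p := by gcongr
        _ = _ := by ring
  · refine l2norm_sub_le_of_box hL.le (by positivity) hθ₀ hβ hJ hasum fun i => ?_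
    have := hθ i
    rw [abs_le]
    constructor <;> linarith [this.1, this.2]

end PriorSmallBall

section Rates

theorem le_mul_rpow_of_rpow_le {ε M y k : ℝ} (hε : 0 < ε) (hM : 0 < M) (hy : 0 < y) (hk : 0 < k)
    (h : ε ^ k ≤ M * y) : ε ≤ M ^ (1 / k) * y ^ (1 / k) := by
  have h1 := Real.rpow_le_rpow (by positivity) h (by positivity : 0 ≤ 1 / k)
  rwa [← Real.rpow_mul hε.le, mul_one_div_cancel hk.ne', Real.rpow_one,
    Real.mul_rpow hM.le hy.le] at h1

theorem le_of_mul_sq_le_div_rpow {α M n τ ε : ℝ} (hα : 0 < α) (hM : 0 < M) (hn : 0 < n)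
    (hτ : 0 < τ) (hε : 0 < ε) (h : n * ε ^ 2 ≤ M * (τ / ε) ^ (1 / α)) :
    ε ≤ M ^ (α / (1 + 2 * α)) * (n ^ (-(α / (1 + 2 * α))) * τ ^ (1 / (1 + 2 * α))) := by
  have hy : 0 < τ ^ (1 / α) / n := by positivity
  have hk : 0 < (1 + 2 * α) / α := by positivity
  have h1 : ε ^ ((1 + 2 * α) / α) ≤ M * (τ ^ (1 / α) / n) := by
    rw [show (1 + 2 * α) / α = (2 : ℕ) + 1 / α by push_cast; field_simp; ring,
      Real.rpow_add hε, Real.rpow_natCast, mul_div_assoc', le_div_iff₀ hn]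
    rw [Real.div_rpow hτ.le hε.le, mul_div_assoc', le_div_iff₀ (by positivity)] at h
    linarith
  have h2 := le_mul_rpow_of_rpow_le hε hM hy hk h1
  rw [one_div_div, Real.div_rpow (by positivity) hn.le, ← Real.rpow_mul hτ.le] at h2
  rw [show 1 / (1 + 2 * α) = 1 / α * (α / (1 + 2 * α)) by field_simp, Real.rpow_neg hn.le]
  refine h2.trans (le_of_eq ?_)
  ring

/-- The Sobolev part of the rate, as a function of `w = n τ ^ p`. -/
def sobolevRate (p α β w : ℝ) : ℝ :=
  if β < α + 1 / p then w ^ (β / (β * (p - 2) - α * p - 1))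
  else if α + 1 / p < β then w ^ (-(1 / 2) : ℝ)
  else w ^ (-(1 / 2) : ℝ) * Real.log (Real.sqrt w) ^ ((1 : ℝ) / 2 - p / 4)

theorem le_mul_inv_sqrt_of_mul_sq_le {ε w M : ℝ} (hw : 0 < w) (hM : 0 ≤ M)
    (h : w * ε ^ 2 ≤ M) : ε ≤ Real.sqrt M * w ^ (-(1 / 2) : ℝ) := by
  rw [Real.rpow_neg hw.le, ← Real.sqrt_eq_rpow, ← div_eq_mul_inv, ← Real.sqrt_div hM]
  refine Real.le_sqrt_of_sq_le ?_
  rw [le_div_iff₀ hw]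
  linarith

theorem sobolevRate_nonneg {p α β w : ℝ} (hp : p ∈ Set.Icc (1 : ℝ) 2) (hw : 0 < w) :
    0 ≤ sobolevRate p α β w := by
  unfold sobolevRate
  split_ifs
  · positivity
  · positivity
  · refine mul_nonneg (by positivity) ?_
    rcases le_or_gt 0 (Real.log (Real.sqrt w)) with h | h
    · exact Real.rpow_nonneg h _
    · rw [Real.rpow_def_of_neg h]
      refine mul_nonneg (Real.exp_pos _).le (Real.cos_nonneg_of_mem_Icc ⟨?_, ?_⟩)
      · nlinarith [Real.pi_pos, hp.1, hp.2]
      · nlinarith [Real.pi_pos, hp.1, hp.2]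

theorem exists_le_sobolevRate {p α β : ℝ} (hp : p ∈ Set.Icc (1 : ℝ) 2) (hβ : 0 < β)
    {M G : ℝ} (hM : 0 < M) (hG : 0 < G) :
    ∃ C : ℝ, 0 < C ∧ ∀ w ε : ℝ, Real.exp 2 ≤ w ∨ β ≠ α + 1 / p → 0 < w → 0 < ε →
      w * ε ^ 2 ≤ M * sobolevEnergyRate p α β ⌊(G / ε) ^ (1 / β)⌋₊ →
      ε ≤ C * sobolevRate p α β w := by
  obtain ⟨hp1, hp2⟩ := hp
  have hp0 : 0 < p := by linarith
  have hpp : p * (1 / p) = 1 := by field_simp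
  unfold sobolevRate sobolevEnergyRate
  rcases lt_trichotomy β (α + 1 / p) with h | h | h
  · have he : 0 < 1 + p * (α - β) := by nlinarith
    have hk : 0 < 2 + (1 + p * (α - β)) / β := by positivity
    set k := 2 + (1 + p * (α - β)) / β with hkdef
    set e := 1 + p * (α - β)
    refine ⟨(M * G ^ (e / β)) ^ (1 / k), by positivity, fun w ε _ hw hε hle => ?_⟩
    rw [if_pos h] at hle ⊢
    have hX : 0 ≤ (G / ε) ^ (1 / β) := by positivity
    have h1 : (⌊(G / ε) ^ (1 / β)⌋₊ : ℝ) ^ e ≤ G ^ (e / β) / ε ^ (e / β) := by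
      refine (Real.rpow_le_rpow (Nat.cast_nonneg _) (Nat.floor_le hX) he.le).trans (le_of_eq ?_)
      rw [← Real.rpow_mul (by positivity), ← Real.div_rpow hG.le hε.le]
      congr 1
      ring
    have h2 : w * ε ^ 2 ≤ M * (G ^ (e / β) / ε ^ (e / β)) :=
      hle.trans (mul_le_mul_of_nonneg_left h1 hM.le)
    have h3 : ε ^ k ≤ M * G ^ (e / β) * w⁻¹ := by
      rw [mul_div_assoc', le_div_iff₀ (by positivity)] at h2
      rw [hkdef, Real.rpow_add hε, Real.rpow_two, ← div_eq_mul_inv, le_div_iff₀ hw]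
      linarith
    have h4 := le_mul_rpow_of_rpow_le hε (by positivity) (inv_pos.2 hw) hk h3
    rw [Real.inv_rpow hw.le, ← Real.rpow_neg hw.le] at h4
    have h5 : -(1 / k) = β / (β * (p - 2) - α * p - 1) := by
      have h6 : k = -(β * (p - 2) - α * p - 1) / β := by
        rw [hkdef]; simp only [e]; field_simp; ring
      rw [h6, one_div_div, div_neg, neg_neg]
    rwa [h5] at h4
  · set G' := |Real.log G| with hG'
    have hC4 : 0 < 1 + 1 / β * (G' + 1) := by positivity
    have hpow : 0 ≤ 1 / 2 - p / 4 := by linarith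
    refine ⟨1 + Real.sqrt M * (1 + 1 / β * (G' + 1)) ^ (1 / 2 - p / 4), by positivity,
      fun w ε hw2 hw hε hle => ?_⟩
    rw [if_neg h.not_lt, if_neg h.symm.not_lt] at hle ⊢
    replace hw2 : Real.exp 2 ≤ w := hw2.resolve_right fun hne => hne h
    set l := Real.log (Real.sqrt w) with hl
    have hl1 : 1 ≤ l := by
      rw [hl, Real.log_sqrt hw.le]
      have := (Real.le_log_iff_exp_le hw).2 hw2
      linarith
    have hlp : 1 ≤ l ^ (1 / 2 - p / 4) := Real.one_le_rpow hl1 hpow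
    have hws : 0 < w ^ (-(1 / 2) : ℝ) := by positivity
    rw [add_mul, one_mul]
    rcases le_or_gt ε (w ^ (-(1 / 2) : ℝ)) with hs | hs
    · refine hs.trans ((le_mul_of_one_le_right hws.le hlp).trans (le_add_of_nonneg_right ?_))
      positivity
    · refine le_trans ?_ (le_add_of_nonneg_left (by positivity))
      have hlogε : -Real.log ε ≤ l := by
        have h1 := Real.log_le_log hws hs.le
        rw [Real.log_rpow hw] at h1
        rw [hl, Real.log_sqrt hw.le]
        linarith
      set J := ⌊(G / ε) ^ (1 / β)⌋₊
      have hJ : 1 + Real.log J ≤ (1 + 1 / β * (G' + 1)) * l := by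
        have hβ' : 0 < 1 / β := by positivity
        have hG0 : 0 ≤ G' := abs_nonneg _
        rcases Nat.eq_zero_or_pos J with hJ0 | hJ0
        · rw [hJ0, Nat.cast_zero, Real.log_zero]
          have : 0 ≤ 1 / β * (G' + 1) * l := by positivity
          linarith
        · have hJX : (J : ℝ) ≤ (G / ε) ^ (1 / β) := Nat.floor_le (by positivity)
          have h1 := Real.log_le_log (by exact_mod_cast hJ0) hJX
          rw [Real.log_rpow (by positivity), Real.log_div hG.ne' hε.ne'] at h1
          have h2 : Real.log G - Real.log ε ≤ (G' + 1) * l := by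
            have := le_abs_self (Real.log G)
            nlinarith
          have h3 := mul_le_mul_of_nonneg_left h2 hβ'.le
          linarith
      have hJ1 : 0 ≤ 1 + Real.log J := by
        have := Real.log_natCast_nonneg J
        linarith
      have h5 := le_mul_inv_sqrt_of_mul_sq_le hw (by positivity) hle
      refine h5.trans ?_
      rw [Real.sqrt_mul hM.le, Real.sqrt_eq_rpow (_ ^ _), ← Real.rpow_mul hJ1,
        show (1 - p / 2) * (1 / 2) = 1 / 2 - p / 4 by ring]
      have h6 := Real.rpow_le_rpow hJ1 hJ hpow
      rw [Real.mul_rpow hC4.le (by linarith)] at h6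
      calc Real.sqrt M * (1 + Real.log J) ^ (1 / 2 - p / 4) * w ^ (-(1 / 2) : ℝ)
          ≤ Real.sqrt M * ((1 + 1 / β * (G' + 1)) ^ (1 / 2 - p / 4) * l ^ (1 / 2 - p / 4)) *
            w ^ (-(1 / 2) : ℝ) := by gcongr
        _ = _ := by ring
  · refine ⟨Real.sqrt M, by positivity, fun w ε _ hw hε hle => ?_⟩
    rw [if_neg h.not_gt, if_pos h, mul_one] at hle
    rw [if_neg h.not_gt, if_pos h]
    exact le_mul_inv_sqrt_of_mul_sq_le hw hM.le hle

/-- When `n τ ^ p` is bounded, the scale `τ` is itself dominated by the first part of the rate. -/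
theorem le_mul_of_mul_rpow_le_exp_two {p α : ℝ} (hp : p ∈ Set.Icc (1 : ℝ) 2) (hα : 0 < α)
    {n τ : ℝ} (hn : 1 ≤ n) (hτ : 0 < τ) (h : n * τ ^ p ≤ Real.exp 2) :
    τ ≤ Real.exp 2 * (n ^ (-(α / (1 + 2 * α))) * τ ^ (1 / (1 + 2 * α))) := by
  obtain ⟨hp1, hp2⟩ := hp
  have hn0 : 0 < n := by linarith
  have hln := Real.log_nonneg hn
  have h1 := Real.log_le_log (by positivity) h
  rw [Real.log_exp, Real.log_mul hn0.ne' (by positivity), Real.log_rpow hτ] at h1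
  rw [← Real.log_le_log_iff hτ (by positivity), Real.log_mul (by positivity) (by positivity),
    Real.log_mul (by positivity) (by positivity), Real.log_exp, Real.log_rpow hn0,
    Real.log_rpow hτ]
  have h2 : Real.log n + 2 * Real.log τ ≤ 4 := by
    rcases le_total (Real.log τ) 0 with ht | ht
    · have : p * Real.log τ ≤ Real.log τ := by nlinarith
      nlinarith
    · nlinarith
  have h3 : 2 + (-(α / (1 + 2 * α)) * Real.log n + 1 / (1 + 2 * α) * Real.log τ) - Real.log τ =
      2 - α / (1 + 2 * α) * (Real.log n + 2 * Real.log τ) := by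
    field_simp
    ring
  have h4 : α / (1 + 2 * α) ≤ 1 / 2 := by
    rw [div_le_div_iff₀ (by positivity) (by norm_num)]
    linarith
  have h5 : 0 ≤ α / (1 + 2 * α) := by positivity
  nlinarith

end Rates

/-- **Lemma 3.3(i)**: upper bounds for `ε_n(α,τ)` under Sobolev regularity of the truth,
with a constant depending on `θ₀` only through `‖θ₀‖_{H^β} ≤ L` and uniform over all `τ`
such that `ε_n(α,τ)/τ` stays bounded. -/
theorem eps_upper_bound_sobolev
    (K : ℝ) (hK : 0 < K)
    (p : ℝ) (hp : p ∈ Set.Icc (1 : ℝ) 2)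
    (α : ℝ) (hα : 0 < α) (β : ℝ) (hβ : 0 < β)
    -- the p-exponential priors Π(·|α,τ), τ > 0
    (Prior : ℝ → Measure (ℕ → ℝ))
    (hPrior : ∀ τ : ℝ, 0 < τ → IsPexpPrior p α τ (Prior τ)) :
    ∀ Ctil L : ℝ, 0 < Ctil → 0 < L →
      ∃ C : ℝ, 0 < C ∧
        ∀ θ₀ : ℕ → ℝ, inSobolevBall β L θ₀ →
          ∀ eps : ℝ → ℕ → ℝ,
            -- eps τ n = ε_n(α,τ): the solution of the small-ball equation
            (∀ τ : ℝ, 0 < τ → ∀ n : ℕ, 1 ≤ n → 0 < eps τ n ∧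
              Prior τ {θ | l2norm (fun i => θ i - θ₀ i) ≤ K * eps τ n} =
                ENNReal.ofReal (Real.exp (-(n : ℝ) * (eps τ n) ^ 2))) →
            ∀ τ : ℝ, 0 < τ → ∀ n : ℕ, 1 ≤ n →
              eps τ n ≤ Ctil * τ →
              eps τ n ≤ C * epsTildeSob p α β n τ := by
  intro Ctil L hCtil hL
  have hp0 : 0 < p := by linarith [hp.1]
  obtain ⟨C₁, C₂, hC₁, hC₂, hball⟩ := exists_le_prior_ball hp hα hβ hK hL
  obtain ⟨C₃, hC₃, hrate⟩ := exists_le_sobolevRate (α := α) hp hβ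
    (by positivity : 0 < 2 * C₂) (by positivity : 0 < 2 * L / K)
  refine ⟨(2 * C₁) ^ (α / (1 + 2 * α)) + C₃ + Ctil * Real.exp 2, by positivity, ?_⟩
  intro θ₀ hθ₀ eps heps τ hτ n hn hle
  obtain ⟨hε, heq⟩ := heps τ hτ n hn
  have hn0 : (0 : ℝ) < n := by exact_mod_cast hn
  have hw : 0 < (n : ℝ) * τ ^ p := by positivity
  have hsplit : epsTildeSob p α β n τ = (n : ℝ) ^ (-(α / (1 + 2 * α))) * τ ^ (1 / (1 + 2 * α)) +
      sobolevRate p α β (n * τ ^ p) := rfl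
  have hfirst : 0 ≤ (n : ℝ) ^ (-(α / (1 + 2 * α))) * τ ^ (1 / (1 + 2 * α)) := by positivity
  have hsecond := sobolevRate_nonneg (α := α) (β := β) hp hw
  rw [hsplit]
  set ε := eps τ n
  set A := (n : ℝ) ^ (-(α / (1 + 2 * α))) * τ ^ (1 / (1 + 2 * α))
  set B := sobolevRate p α β (n * τ ^ p)
  have hM : 0 ≤ (2 * C₁) ^ (α / (1 + 2 * α)) := by positivity
  set M := (2 * C₁) ^ (α / (1 + 2 * α))
  have hE : 0 < Ctil * Real.exp 2 := by positivity
  suffices ε ≤ M * A ∨ ε ≤ C₃ * B ∨ ε ≤ Ctil * Real.exp 2 * A by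
    have e1 : 0 ≤ M * A := by positivity
    have e2 : 0 ≤ M * B := by positivity
    have e3 : 0 ≤ C₃ * A := by positivity
    have e4 : 0 ≤ C₃ * B := by positivity
    have e5 : 0 ≤ Ctil * Real.exp 2 * A := by positivity
    have e6 : 0 ≤ Ctil * Real.exp 2 * B := by positivity
    rcases this with h | h | h <;> linarith
  by_cases hcase : Real.exp 2 ≤ (n : ℝ) * τ ^ p ∨ β ≠ α + 1 / p
  · set J := ⌊(2 * L / K / ε) ^ (1 / β)⌋₊ with hJdef
    have hJ : (2 * L / (K * ε)) ^ (1 / β) ≤ J + 1 := by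
      rw [← div_div]
      exact (Nat.lt_floor_add_one _).le
    have hprob := hball θ₀ hθ₀ τ ε J (Prior τ) hτ hε (hPrior τ hτ) hJ
    rw [heq, ENNReal.ofReal_le_ofReal_iff (Real.exp_pos _).le, Real.exp_le_exp, neg_mul,
      neg_le_neg_iff] at hprob
    rcases le_total (C₂ * (τ ^ (-p) * sobolevEnergyRate p α β J)) (C₁ * (τ / ε) ^ (1 / α))
      with h | h
    · exact Or.inl (le_of_mul_sq_le_div_rpow hα (by positivity) hn0 hτ hε (by linarith))
    · refine Or.inr (Or.inl (hrate _ ε hcase hw hε ?_))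
      have h1 : (n : ℝ) * ε ^ 2 ≤ 2 * C₂ * sobolevEnergyRate p α β J / τ ^ p := by
        rw [Real.rpow_neg hτ.le] at h hprob
        calc (n : ℝ) * ε ^ 2 ≤ 2 * (C₂ * ((τ ^ p)⁻¹ * sobolevEnergyRate p α β J)) := by linarith
          _ = _ := by ring
      rw [le_div_iff₀ (by positivity)] at h1
      linarith
  · push Not at hcase
    refine Or.inr (Or.inr (hle.trans ?_))
    rw [mul_assoc]
    exact mul_le_mul_of_nonneg_left
      (le_mul_of_mul_rpow_le_exp_two hp hα (by exact_mod_cast hn) hτ hcase.1.le) hCtil.le
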